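/- Let f : ℝ² → ℍ with ∫_{ℝ²} |f(s,t)| ds dt < ∞, and suppose its right-sided quaternion Fourier transform 𝓕_R satisfies ∫_{ℝ²} |𝓕_R(u,v)| du dv < ∞. Then f(s,t) = (1/(4π²)) ∫_{ℝ²} 𝓕_R(u,v) e^{j t v} e^{i s u} du dv for almost every (s,t) ∈ ℝ². -/

import Mathlib

open MeasureTheory Filter Real Set
open scoped Quaternion Topology

noncomputable section

def qi : ℍ[ℝ] := ⟨0,1,0,0⟩
def qj : ℍ[ℝ] := ⟨0,0,1,0⟩

/-- `e^{μθ} = cos θ + μ sin θ` for a (pure unit) quaternion `μ`. -/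
def qexp (μ : ℍ[ℝ]) (θ : ℝ) : ℍ[ℝ] := (Real.cos θ : ℍ[ℝ]) + Real.sin θ • μ

/-- Right-sided quaternion Fourier transform. -/
def QFT_R (f : ℝ × ℝ → ℍ[ℝ]) (u v : ℝ) : ℍ[ℝ] :=
  ∫ p : ℝ × ℝ, f p * qexp qi (-(u * p.1)) * qexp qj (-(v * p.2))


open scoped FourierTransform SchwartzMap ContDiff in
theorem complex_inv {V : Type*} [NormedAddCommGroup V] [InnerProductSpace ℝ V]
    [MeasurableSpace V] [BorelSpace V] [FiniteDimensional ℝ V]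
    (z : V → ℂ) (hz : Integrable z) (hZ : Integrable (𝓕 z)) :
    ∀ᵐ x, z x = 𝓕⁻ (𝓕 z) x := by
  have hcont : Continuous (𝓕⁻ (𝓕 z)) := by
    have h := VectorFourier.fourierIntegral_continuous (μ := (volume : Measure V))
      (L := -innerₗ V) Real.continuous_fourierChar
      (continuous_inner (𝕜 := ℝ) (E := V)).neg hZ
    exact h
  apply ae_eq_of_integral_contDiff_smul_eq hz.locallyIntegrable hcont.locallyIntegrable
  intro g hg hgs
  have hs : HasCompactSupport (fun x => (g x : ℂ)) := hgs.comp_left (g := ((↑) : ℝ → ℂ)) (by simp)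
  have hd : ContDiff ℝ ∞ (fun x => (g x : ℂ)) := Complex.ofRealCLM.contDiff.comp hg
  let S : 𝓢(V, ℂ) := hs.toSchwartzMap hd
  have hS : ∀ x, S x = (g x : ℂ) := fun x => rfl
  let T : 𝓢(V, ℂ) := 𝓕⁻ S
  have h1 := VectorFourier.integral_fourierIntegral_smul_eq_flip (L := innerₗ V)
      (μ := (volume : Measure V)) (ν := (volume : Measure V))
      Real.continuous_fourierChar continuous_inner T.integrable hz
  have h2 := VectorFourier.integral_fourierIntegral_smul_eq_flip (L := -innerₗ V)
      (μ := (volume : Measure V)) (ν := (volume : Measure V))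
      Real.continuous_fourierChar (continuous_inner (𝕜 := ℝ) (E := V)).neg
      S.integrable hZ
  have e1 : ∀ x, VectorFourier.fourierIntegral 𝐞 volume (innerₗ V) T x = (g x : ℂ) := by
    intro x
    have : (𝓕 T) x = S x := by simp only [T]; rw [FourierTransform.fourier_fourierInv_eq]
    rw [← hS, ← this, SchwartzMap.fourier_coe]
    rfl
  have e2 : ∀ x, VectorFourier.fourierIntegral 𝐞 volume (-innerₗ V) S x = T x := by
    intro x
    simp only [T]
    rw [SchwartzMap.fourierInv_coe]; rfl
  have e3 : ∀ x, VectorFourier.fourierIntegral 𝐞 volume (innerₗ V).flip z x = 𝓕 z x := by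
    intro x
    rw [flip_innerₗ]; rfl
  have e4 : ∀ x, VectorFourier.fourierIntegral 𝐞 volume (-innerₗ V).flip (𝓕 z) x
      = 𝓕⁻ (𝓕 z) x := by
    intro x
    have : (-innerₗ V).flip = -innerₗ V := by
      ext a b; simp [real_inner_comm]
    rw [this]; rfl
  simp only [e1, e3] at h1
  simp only [e2, e4, hS] at h2
  simp only [← Complex.coe_smul] 
  rw [h1, h2]

theorem finrank_R2 : Module.finrank ℝ (WithLp 2 (ℝ × ℝ)) = 2 := by
  rw [(WithLp.linearEquiv 2 ℝ (ℝ × ℝ)).finrank_eq]; simp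

open scoped FourierTransform in
theorem complex_inv_R2 (z : ℝ × ℝ → ℂ) (hz : Integrable z)
    (Z : ℝ × ℝ → ℂ)
    (hZdef : ∀ q, Z q = ∫ p : ℝ × ℝ, z p * Complex.exp (((-(q.1 * p.1 + q.2 * p.2) : ℝ) : ℂ) * Complex.I))
    (hZ : Integrable Z) :
    ∀ᵐ p : ℝ × ℝ, z p = ((1 / (4 * π ^ 2) : ℝ) : ℂ) *
      ∫ q : ℝ × ℝ, Z q * Complex.exp (((p.1 * q.1 + p.2 * q.2 : ℝ) : ℂ) * Complex.I) := by
  have mp := WithLp.volume_preserving_ofLp ℝ ℝ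
  have mp' := WithLp.volume_preserving_toLp ℝ ℝ
  have me : MeasurableEmbedding (@WithLp.ofLp 2 (ℝ × ℝ)) :=
    (MeasurableEquiv.toLp 2 (ℝ × ℝ)).symm.measurableEmbedding
  let w : WithLp 2 (ℝ × ℝ) → ℂ := z ∘ WithLp.ofLp
  have hw : Integrable w := mp.integrable_comp_of_integrable hz
  have hFw : ∀ x : WithLp 2 (ℝ × ℝ), 𝓕 w x = Z ((2 * π) • WithLp.ofLp x) := by
    intro x
    rw [Real.fourier_eq', hZdef, ← mp.integral_comp me]
    congr 1
    ext v
    simp only [w, smul_eq_mul, Function.comp]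
    rw [mul_comm]
    congr 4
    simp [WithLp.prod_inner_apply]
    ring
  have hFwi : Integrable (𝓕 w) := by
    rw [show 𝓕 w = (fun q => Z ((2 * π) • q)) ∘ WithLp.ofLp from funext hFw]
    exact mp.integrable_comp_of_integrable (hZ.comp_smul (by positivity))
  have key := mp'.quasiMeasurePreserving.ae (complex_inv w hw hFwi)
  filter_upwards [key] with p hp
  have : w (WithLp.toLp 2 p) = z p := rfl
  rw [← this, hp, Real.fourierInv_eq']
  simp only [hFw]
  have h3 := mp.integral_comp me (fun q : ℝ × ℝ => (fun q : ℝ × ℝ => Z q * Complex.exp (((p.1 * q.1 + p.2 * q.2 : ℝ) : ℂ) * Complex.I)) ((2 * π) • q))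
  rw [Measure.integral_comp_smul volume (fun q : ℝ × ℝ => Z q * Complex.exp (((p.1 * q.1 + p.2 * q.2 : ℝ) : ℂ) * Complex.I)) (2 * π)] at h3
  rw [show ((1 / (4 * π ^ 2) : ℝ) : ℂ) = ((|((2 * π) ^ Module.finrank ℝ (ℝ × ℝ))⁻¹| : ℝ) : ℂ) by
    rw [abs_of_pos (by positivity)]
    simp
    ring]
  rw [← Complex.real_smul, ← h3]
  congr 1
  ext v
  rw [smul_eq_mul, mul_comm]
  congr 4
  simp [WithLp.prod_inner_apply]
  ring

@[simp] theorem qi_re : qi.re = 0 := rfl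
@[simp] theorem qi_imI : qi.imI = 1 := rfl
@[simp] theorem qi_imJ : qi.imJ = 0 := rfl
@[simp] theorem qi_imK : qi.imK = 0 := rfl
@[simp] theorem qj_re : qj.re = 0 := rfl
@[simp] theorem qj_imI : qj.imI = 0 := rfl
@[simp] theorem qj_imJ : qj.imJ = 1 := rfl
@[simp] theorem qj_imK : qj.imK = 0 := rfl

def projA : ℍ[ℝ] →L[ℝ] ℂ := LinearMap.toContinuousLinearMap
  { toFun := fun q => ⟨q.re, q.imI⟩
    map_add' := by intro a b; apply Complex.ext <;> simp
    map_smul' := by intro a b; apply Complex.ext <;> simp }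

def projB : ℍ[ℝ] →L[ℝ] ℂ := LinearMap.toContinuousLinearMap
  { toFun := fun q => ⟨q.imJ, -q.imK⟩
    map_add' := by intro a b; apply Complex.ext <;> simp; ring
    map_smul' := by intro a b; apply Complex.ext <;> simp }

theorem projA_apply (q : ℍ[ℝ]) : projA q = ⟨q.re, q.imI⟩ := rfl
theorem projB_apply (q : ℍ[ℝ]) : projB q = ⟨q.imJ, -q.imK⟩ := rfl

theorem projA_mul (q : ℍ[ℝ]) (θ : ℝ) :
    projA (q * qexp qi θ) = projA q * Complex.exp ((θ : ℂ) * Complex.I) := by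
  rw [projA_apply, projA_apply]
  apply Complex.ext <;>
    simp [qexp, Complex.exp_ofReal_mul_I_re, Complex.exp_ofReal_mul_I_im]

theorem projB_mul (q : ℍ[ℝ]) (θ : ℝ) :
    projB (q * qexp qi θ) = projB q * Complex.exp ((θ : ℂ) * Complex.I) := by
  rw [projB_apply, projB_apply]
  apply Complex.ext <;>
    simp [qexp, Complex.exp_ofReal_mul_I_re, Complex.exp_ofReal_mul_I_im] <;> ring

theorem norm_qexp_qi (θ : ℝ) : ‖qexp qi θ‖ = 1 := by
  have h : ‖qexp qi θ‖ * ‖qexp qi θ‖ = 1 := by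
    rw [← Quaternion.normSq_eq_norm_mul_self, Quaternion.normSq_def']
    simp [qexp]
  nlinarith [norm_nonneg (qexp qi θ)]

theorem norm_qexp_qj (θ : ℝ) : ‖qexp qj θ‖ = 1 := by
  have h : ‖qexp qj θ‖ * ‖qexp qj θ‖ = 1 := by
    rw [← Quaternion.normSq_eq_norm_mul_self, Quaternion.normSq_def']
    simp [qexp]
  nlinarith [norm_nonneg (qexp qj θ)]

theorem continuous_qexp (μ : ℍ[ℝ]) : Continuous (qexp μ) := by
  unfold qexp
  exact (Quaternion.continuous_coe.comp Real.continuous_cos).add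
    (Real.continuous_sin.smul continuous_const)

theorem integrable_mul_bdd {f h : ℝ × ℝ → ℍ[ℝ]} (hf : Integrable f) (hc : Continuous h)
    (hb : ∀ p, ‖h p‖ ≤ 1) : Integrable (fun p => f p * h p) := by
  refine hf.mono (hf.1.mul hc.aestronglyMeasurable) (Eventually.of_forall fun p => ?_)
  rw [norm_mul]
  exact mul_le_of_le_one_right (norm_nonneg _) (hb p)

theorem integrable_mul_qi {f : ℝ × ℝ → ℍ[ℝ]} (hf : Integrable f) {a : ℝ × ℝ → ℝ}
    (ha : Continuous a) : Integrable (fun p => f p * qexp qi (a p)) :=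
  integrable_mul_bdd hf ((continuous_qexp qi).comp ha) fun p => (norm_qexp_qi _).le

theorem integrable_mul_qj {f : ℝ × ℝ → ℍ[ℝ]} (hf : Integrable f) {a : ℝ × ℝ → ℝ}
    (ha : Continuous a) : Integrable (fun p => f p * qexp qj (a p)) :=
  integrable_mul_bdd hf ((continuous_qexp qj).comp ha) fun p => (norm_qexp_qj _).le

theorem quat_inv (f G : ℝ × ℝ → ℍ[ℝ]) (hf : Integrable f)
    (hG : ∀ q, G q = ∫ p : ℝ × ℝ, f p * qexp qi (-(q.1 * p.1 + q.2 * p.2)))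
    (hGi : Integrable G) :
    ∀ᵐ p : ℝ × ℝ, f p = (1 / (4 * π ^ 2)) •
      ∫ q : ℝ × ℝ, G q * qexp qi (p.1 * q.1 + p.2 * q.2) := by
  have hA := complex_inv_R2 (fun p => projA (f p)) (projA.integrable_comp hf)
    (fun q => projA (G q)) (fun q => by
      simp only [hG, ← projA_mul]
      exact (projA.integral_comp_comm (integrable_mul_qi hf (by fun_prop))).symm)
    (projA.integrable_comp hGi)
  have hB := complex_inv_R2 (fun p => projB (f p)) (projB.integrable_comp hf)
    (fun q => projB (G q)) (fun q => by
      simp only [hG, ← projB_mul]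
      exact (projB.integral_comp_comm (integrable_mul_qi hf (by fun_prop))).symm)
    (projB.integrable_comp hGi)
  filter_upwards [hA, hB] with p h1 h2
  simp only [← projA_mul] at h1
  simp only [← projB_mul] at h2
  rw [projA.integral_comp_comm (integrable_mul_qi hGi (by fun_prop)), ← smul_eq_mul,
    Complex.coe_smul, ← map_smul, projA_apply, projA_apply] at h1
  rw [projB.integral_comp_comm (integrable_mul_qi hGi (by fun_prop)), ← smul_eq_mul,
    Complex.coe_smul, ← map_smul, projB_apply, projB_apply] at h2
  rw [Complex.mk.injEq] at h1 h2
  have h3 := neg_inj.mp h2.2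
  ext
  exacts [h1.1, h1.2, h2.1, h3]

theorem flip_mp : MeasurePreserving (fun q : ℝ × ℝ => (q.1, -q.2)) :=
  (MeasurePreserving.id volume).prod (Measure.measurePreserving_neg volume)

theorem flip_me : MeasurableEmbedding (fun q : ℝ × ℝ => (q.1, -q.2)) :=
  ((MeasurableEquiv.refl ℝ).prodCongr (MeasurableEquiv.neg ℝ)).measurableEmbedding

theorem qj_mul_qj : qj * qj = -1 := by
  ext <;> simp

theorem integral_odd (D : ℝ × ℝ → ℍ[ℝ]) (hD : ∀ q, D (q.1, -q.2) = - D q) : ∫ q, D q = 0 := by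
  have h := flip_mp.integral_comp flip_me D
  simp only [hD, integral_neg] at h
  have h2 : (2 : ℝ) • (∫ q, D q) = 0 := by
    rw [two_smul]
    nth_rewrite 1 [← h]
    exact neg_add_cancel _
  simpa using h2

/-- Inversion theorem for the right-sided QFT of an integrable function with integrable QFT. -/
theorem qft_right_sided_inversion_L1
    (f : ℝ × ℝ → ℍ[ℝ]) (hf : Integrable f)
    (hF : Integrable (fun p : ℝ × ℝ => QFT_R f p.1 p.2)) :
    ∀ᵐ p : ℝ × ℝ, f p =
      (1 / (4 * π ^ 2)) • ∫ q : ℝ × ℝ, QFT_R f q.1 q.2 * qexp qj (p.2 * q.2) * qexp qi (p.1 * q.1) := by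
  let A : ℝ × ℝ → ℍ[ℝ] := fun q =>
    ∫ p : ℝ × ℝ, f p * qexp qi (-(q.1 * p.1)) * ((Real.cos (q.2 * p.2) : ℝ) : ℍ[ℝ])
  let B : ℝ × ℝ → ℍ[ℝ] := fun q =>
    ∫ p : ℝ × ℝ, f p * qexp qi (-(q.1 * p.1)) * ((Real.sin (q.2 * p.2) : ℝ) : ℍ[ℝ])
  have iA : ∀ q : ℝ × ℝ, Integrable (fun p : ℝ × ℝ =>
      f p * qexp qi (-(q.1 * p.1)) * ((Real.cos (q.2 * p.2) : ℝ) : ℍ[ℝ])) := fun q =>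
    integrable_mul_bdd (integrable_mul_qi hf (by fun_prop))
      (Quaternion.continuous_coe.comp (by fun_prop))
      (fun p => by simpa using Real.abs_cos_le_one _)
  have iB : ∀ q : ℝ × ℝ, Integrable (fun p : ℝ × ℝ =>
      f p * qexp qi (-(q.1 * p.1)) * ((Real.sin (q.2 * p.2) : ℝ) : ℍ[ℝ])) := fun q =>
    integrable_mul_bdd (integrable_mul_qi hf (by fun_prop))
      (Quaternion.continuous_coe.comp (by fun_prop))
      (fun p => by simpa using Real.abs_sin_le_one _)
  have Aflip : ∀ q : ℝ × ℝ, A (q.1, -q.2) = A q := fun q => by simp [A]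
  have Bflip : ∀ q : ℝ × ℝ, B (q.1, -q.2) = - B q := fun q => by
    simp [B, integral_neg]
  have hFAB : ∀ q : ℝ × ℝ, QFT_R f q.1 q.2 = A q - B q * qj := by
    intro q
    simp only [A, B, QFT_R]
    rw [← integral_mul_const_of_integrable (iB q), ← integral_sub (iA q) ((iB q).mul_const qj)]
    congr 1
    ext1 p
    have : qexp qj (-(q.2 * p.2)) = ((Real.cos (q.2 * p.2) : ℝ) : ℍ[ℝ])
        - ((Real.sin (q.2 * p.2) : ℝ) : ℍ[ℝ]) * qj := by
      ext <;> simp [qexp]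
    rw [this, mul_sub, ← mul_assoc]
  have hF' : Integrable (fun q : ℝ × ℝ => A q + B q * qj) := by
    have := flip_mp.integrable_comp_of_integrable hF
    refine this.congr (Eventually.of_forall fun q => ?_)
    have h := hFAB (q.1, -q.2)
    rw [Aflip, Bflip] at h
    simpa using h
  simp only [hFAB] at hF ⊢
  have hAi : Integrable A := by
    refine ((hF.add hF').smul (1 / 2 : ℝ)).congr (Eventually.of_forall fun q => ?_)
    simp only [Pi.smul_apply, Pi.add_apply]
    module
  have hBi : Integrable B := by
    refine (((hF.sub hF').smul (1 / 2 : ℝ)).mul_const qj).congr (Eventually.of_forall fun q => ?_)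
    simp only [Pi.smul_apply, Pi.sub_apply]
    rw [show (1 / 2 : ℝ) • (A q - B q * qj - (A q + B q * qj)) = - (B q * qj) by module,
      neg_mul, mul_assoc, qj_mul_qj]
    simp
  have main := quat_inv f (fun q => A q - B q * qi) hf (fun q => by
    simp only [A, B]
    rw [← integral_mul_const_of_integrable (iB q), ← integral_sub (iA q) ((iB q).mul_const qi)]
    congr 1
    ext1 p
    have : qexp qi (-(q.1 * p.1 + q.2 * p.2)) = qexp qi (-(q.1 * p.1)) *
        (((Real.cos (q.2 * p.2) : ℝ) : ℍ[ℝ]) - ((Real.sin (q.2 * p.2) : ℝ) : ℍ[ℝ]) * qi) := by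
      ext <;> simp [qexp, Real.cos_add, Real.sin_add] <;> ring
    rw [this, ← mul_assoc, mul_sub, ← mul_assoc]) (hAi.sub (hBi.mul_const qi))
  filter_upwards [main] with p hp
  rw [hp]
  congr 1
  have i1 : Integrable (fun q : ℝ × ℝ => (A q - B q * qi) * qexp qi (p.1 * q.1 + p.2 * q.2)) :=
    integrable_mul_qi (hAi.sub (hBi.mul_const qi)) (by fun_prop)
  have i2 : Integrable (fun q : ℝ × ℝ =>
      (A q - B q * qj) * qexp qj (p.2 * q.2) * qexp qi (p.1 * q.1)) :=
    integrable_mul_qi (integrable_mul_qj hF (by fun_prop)) (by fun_prop)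
  rw [← sub_eq_zero, ← integral_sub i1 i2]
  have hD : ∀ q : ℝ × ℝ, (A q - B q * qi) * qexp qi (p.1 * q.1 + p.2 * q.2)
      - (A q - B q * qj) * qexp qj (p.2 * q.2) * qexp qi (p.1 * q.1)
      = (Real.sin (p.2 * q.2) • A q - Real.cos (p.2 * q.2) • B q) * (qi - qj)
        * qexp qi (p.1 * q.1) := by
    intro q
    ext <;> simp [qexp, Real.cos_add, Real.sin_add] <;> ring
  simp only [hD]
  apply integral_odd
  intro q
  simp only [Aflip, Bflip, mul_neg, Real.sin_neg, Real.cos_neg]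
  rw [← neg_mul, ← neg_mul]
  congr 2
  module
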